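/- Let R be a commutative ring, m ∈ R, n ≥ 1, and let a_{i,j} denote the (i,j) entry of T_n(m). Then for every 1 ≤ i ≤ n: ∑_{j=1}^n ∑_{k=1}^n (-1)^{n+1-j}·a_{i,k}·a_{k,j}·U_{n-j} = U_{n+i-2}; equivalently, ∑_{j=1}^n ∑_{k=1}^n (-1)^{n+1-j}·m^{i+j+2k-2n-2}·C(i-1, n-k)·C(k-1, n-j)·U_{n-j} = U_{n+i-2}, where a term is 0 whenever either binomial coefficient vanishes. -/

import Mathlib

/-- The generalized Fibonacci sequence with parameter `m`:
`U_0 = 0`, `U_1 = 1`, `U_{e+1} = m U_e + U_{e-1}`. -/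
def genFibU {R : Type*} [CommRing R] (m : R) : ℕ → R
  | 0 => 0
  | 1 => 1
  | e + 2 => m * genFibU m (e + 1) + genFibU m e

/-- The `n × n` generalized Fibonacci matrix `T_n(m)`, with 1-based `(i,j)` entry
`m^{i+j-n-1} C(i-1, n-j)` when `i + j ≥ n + 1` and `0` otherwise. -/
def genFibMatrix {R : Type*} [CommRing R] (m : R) (n : ℕ) :
    Matrix (Fin n) (Fin n) R :=
  Matrix.of fun i j =>
    if n ≤ i.val + j.val + 1 then
      m ^ (i.val + j.val + 1 - n) * (Nat.choose i.val (n - 1 - j.val) : R)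
    else 0

/-- Binomial transform. -/
def gfS {R : Type*} [CommRing R] (m : R) (k : ℕ) (f : ℕ → R) : R :=
  ∑ l ∈ Finset.range (k + 1), m ^ (k - l) * (Nat.choose k l : R) * f l

theorem gfS_succ {R : Type*} [CommRing R] (m : R) (k : ℕ) (f : ℕ → R) :
    gfS m (k + 1) f = m * gfS m k f + gfS m k (fun l => f (l + 1)) := by
  unfold gfS
  rw [Finset.sum_range_succ']
  have h1 : ∀ l ∈ Finset.range (k + 1),
      m ^ (k + 1 - (l + 1)) * (Nat.choose (k + 1) (l + 1) : R) * f (l + 1) =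
      m ^ (k - l) * (Nat.choose k l : R) * f (l + 1) +
      m ^ (k - l) * (Nat.choose k (l + 1) : R) * f (l + 1) := by
    intro l _
    rw [Nat.choose_succ_succ, Nat.add_sub_add_right]
    push_cast
    ring
  rw [Finset.sum_congr rfl h1, Finset.sum_add_distrib]
  have h2 : m * ∑ l ∈ Finset.range (k + 1), m ^ (k - l) * (Nat.choose k l : R) * f l =
      ∑ l ∈ Finset.range (k + 1), m ^ (k - l) * (Nat.choose k (l + 1) : R) * f (l + 1) +
        m ^ (k + 1) * f 0 := by
    rw [Finset.sum_range_succ', Finset.sum_range_succ _ k, mul_add, Finset.mul_sum]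
    simp only [Nat.choose_succ_self, Nat.choose_zero_right, Nat.sub_zero]
    have : ∀ l ∈ Finset.range k,
        m * (m ^ (k - (l + 1)) * (Nat.choose k (l + 1) : R) * f (l + 1)) =
        m ^ (k - l) * (Nat.choose k (l + 1) : R) * f (l + 1) := by
      intro l hl
      have hl := Finset.mem_range.1 hl
      rw [show k - l = (k - (l + 1)) + 1 by omega]
      ring
    rw [Finset.sum_congr rfl this]
    push_cast
    ring
  rw [h2]
  simp
  ring

theorem gfS_alt {R : Type*} [CommRing R] (m : R) (k : ℕ) :
    gfS m k (fun l => (-1) ^ (l + 1) * genFibU m l) = genFibU m k := by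
  have hrec : ∀ k, gfS m (k + 2) (fun l => (-1) ^ (l + 1) * genFibU m l) =
      m * gfS m (k + 1) (fun l => (-1) ^ (l + 1) * genFibU m l) +
        gfS m k (fun l => (-1) ^ (l + 1) * genFibU m l) := by
    intro k
    rw [gfS_succ, gfS_succ m k (fun l => (-1) ^ (l + 1 + 1) * genFibU m (l + 1))]
    congr 1
    unfold gfS
    rw [Finset.mul_sum, ← Finset.sum_add_distrib]
    refine Finset.sum_congr rfl fun l _ => ?_
    beta_reduce
    rw [show genFibU m (l + 1 + 1) = m * genFibU m (l + 1) + genFibU m l from rfl]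
    ring
  induction k using Nat.twoStepInduction with
  | zero => simp [gfS, genFibU]
  | one => simp [gfS, genFibU, Finset.sum_range_succ]
  | more k h1 h2 => rw [hrec, h1, h2]; rfl

theorem gfS_rev {R : Type*} [CommRing R] (m : R) (i : ℕ) : ∀ N, i ≤ N →
    gfS m i (fun l => genFibU m (N - l)) = genFibU m (N + i) := by
  induction i with
  | zero => intro N _; simp [gfS]
  | succ i ih =>
    intro N hN
    obtain ⟨M, rfl⟩ : ∃ M, N = M + 1 := ⟨N - 1, by omega⟩
    rw [gfS_succ, ih _ (by omega)]
    simp only [Nat.add_sub_add_right]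
    rw [ih _ (by omega), show M + 1 + (i + 1) = (M + i) + 2 by omega,
      show M + 1 + i = M + i + 1 by omega]
    rfl

theorem genFibMatrix_row {R : Type*} [CommRing R] (m : R) (n : ℕ) (i : Fin n) (f : ℕ → R) :
    ∑ j : Fin n, genFibMatrix m n i j * f (n - 1 - j.val) = gfS m i.val f := by
  have hi := i.isLt
  rw [← Equiv.sum_comp Fin.revPerm]
  have h : ∀ j : Fin n, genFibMatrix m n i (Fin.revPerm j) * f (n - 1 - (Fin.revPerm j).val) =
      m ^ (i.val - j.val) * (Nat.choose i.val j.val : R) * f j.val := by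
    intro j
    have hj := j.isLt
    simp only [genFibMatrix, Matrix.of_apply, Fin.revPerm_apply, Fin.val_rev]
    rw [show n - 1 - (n - (j.val + 1)) = j.val by omega,
      show i.val + (n - (j.val + 1)) + 1 - n = i.val - j.val by omega]
    split_ifs with hc
    · rfl
    · rw [Nat.choose_eq_zero_of_lt (by omega)]
      simp
  rw [Finset.sum_congr rfl fun j _ => h j,
    Fin.sum_univ_eq_sum_range (fun l => m ^ (i.val - l) * (Nat.choose i.val l : R) * f l) n]
  symm
  unfold gfS
  apply Finset.sum_subset
  · intro x hx
    simp only [Finset.mem_range] at *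
    omega
  · intro x _ hx
    simp only [Finset.mem_range] at hx
    rw [Nat.choose_eq_zero_of_lt (by omega)]
    simp

/-- For every row `i` (1-based) of `T_n(m)`:
`∑_{j=1}^n ∑_{k=1}^n (-1)^{n+1-j} a_{i,k} a_{k,j} U_{n-j} = U_{n+i-2}`. -/
theorem genFibMatrix_sq_row_sum {R : Type*} [CommRing R] (m : R) (n : ℕ) (hn : 1 ≤ n) :
    ∀ i : Fin n,
      ∑ j : Fin n, ∑ k : Fin n,
          (-1 : R) ^ (n - j.val) * genFibMatrix m n i k * genFibMatrix m n k j *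
            genFibU m (n - 1 - j.val) =
        genFibU m (n + i.val - 1) := by
  intro i
  have hi := i.isLt
  rw [Finset.sum_comm]
  have h : ∀ k : Fin n, ∑ j : Fin n,
      (-1 : R) ^ (n - j.val) * genFibMatrix m n i k * genFibMatrix m n k j *
        genFibU m (n - 1 - j.val) =
      genFibMatrix m n i k * genFibU m (n - 1 - (n - 1 - k.val)) := by
    intro k
    have hk := k.isLt
    rw [show n - 1 - (n - 1 - k.val) = k.val by omega, ← gfS_alt, ← genFibMatrix_row m n k,
      Finset.mul_sum]
    refine Finset.sum_congr rfl fun j _ => ?_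
    have hj := j.isLt
    rw [show n - j.val = n - 1 - j.val + 1 by omega]
    ring
  rw [Finset.sum_congr rfl fun k _ => h k,
    genFibMatrix_row m n i (fun l => genFibU m (n - 1 - l)), gfS_rev m i.val (n - 1) (by omega),
    show n - 1 + i.val = n + i.val - 1 by omega]
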